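/- Let (X,𝒞) be an RX3C instance with |X| = 3κ, κ ≥ 1, and let r ≥ 4 be an integer. Consider the approval election with candidate set C = X ∪ {p}, p ∉ X, whose votes are: for each x ∈ X, κ−1 votes each equal to {x}, and for each H ∈ 𝒞 one vote equal to H. Then it is possible to select at most κ votes and replace each selected vote v by an arbitrary vote v' ⊆ C with Hamming distance |v∖v'| + |v'∖v| ≤ r, so that in the resulting election no candidate of X belongs to any winning 1-committee under SAV, if and only if 𝒞 contains an exact cover of X. -/

import Mathlib

namespace ApprovalBribery

variable {α : Type*} [DecidableEq α]

/-- AV score of a candidate: number of votes approving it. -/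
def avScore (V : Multiset (Finset α)) (c : α) : ℕ :=
  (V.map fun v => if c ∈ v then 1 else 0).sum

/-- AV score of a committee. -/
def avCom (V : Multiset (Finset α)) (w : Finset α) : ℕ :=
  (V.map fun v => (v ∩ w).card).sum

/-- SAV score of a candidate. -/
def savScore (V : Multiset (Finset α)) (c : α) : ℚ :=
  (V.map fun v => if c ∈ v then ((v.card : ℚ))⁻¹ else 0).sum

/-- NSAV score of a candidate in an election with candidate set `C`. -/
def nsavScore (C : Finset α) (V : Multiset (Finset α)) (c : α) : ℚ :=
  savScore V c -
    (V.map fun v => if c ∉ v ∧ v ≠ C then ((C.card : ℚ) - (v.card : ℚ))⁻¹ else 0).sum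

/-- SAV score of a committee. -/
def savCom (V : Multiset (Finset α)) (w : Finset α) : ℚ :=
  (V.map fun v => ((v ∩ w).card : ℚ) / (v.card : ℚ)).sum

/-- CCAV score of a committee. -/
def ccavCom (V : Multiset (Finset α)) (w : Finset α) : ℕ :=
  (V.map fun v => if v ∩ w ≠ ∅ then 1 else 0).sum

/-- PAV score of a committee. -/
def pavCom (V : Multiset (Finset α)) (w : Finset α) : ℚ :=
  (V.map fun v => ∑ i ∈ Finset.range (v ∩ w).card, ((i : ℚ) + 1)⁻¹).sum

/-- `w` is a winning `k`-committee for the scoring function `score` in an election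
with candidate set `C`. -/
def IsWinningCommittee {β : Type*} [Preorder β] (C : Finset α) (k : ℕ)
    (score : Finset α → β) (w : Finset α) : Prop :=
  w ⊆ C ∧ w.card = k ∧ ∀ w' ⊆ C, w'.card = k → score w' ≤ score w

/-- `V'` is obtained from `V` by performing at most `ℓ` single approval additions,
each of which inserts one candidate of `C` into one vote not already containing it. -/
def ApprovalAdds (C : Finset α) (V V' : Multiset (Finset α)) (ℓ : ℕ) : Prop :=
  ∃ P : Multiset (Finset α × Finset α),
    V = P.map Prod.fst ∧ V' = P.map Prod.snd ∧
    (∀ q ∈ P, q.1 ⊆ q.2 ∧ q.2 ⊆ C) ∧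
    (P.map fun q => (q.2 \ q.1).card).sum ≤ ℓ

/-- `V'` is obtained from `V` by performing at most `ℓ` single approval deletions,
each of which removes one candidate from one vote containing it. -/
def ApprovalDels (V V' : Multiset (Finset α)) (ℓ : ℕ) : Prop :=
  ∃ P : Multiset (Finset α × Finset α),
    V = P.map Prod.fst ∧ V' = P.map Prod.snd ∧
    (∀ q ∈ P, q.2 ⊆ q.1) ∧
    (P.map fun q => (q.1 \ q.2).card).sum ≤ ℓ

/-- `V'` is obtained from `V` by selecting at most `ℓ` votes and replacing each selected
vote by an arbitrary vote over `C` within Hamming distance `r` of it. -/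
def VoteChanges (C : Finset α) (V V' : Multiset (Finset α)) (ℓ r : ℕ) : Prop :=
  ∃ P : Multiset (Finset α × Finset α),
    V = P.map Prod.fst ∧ V' = P.map Prod.snd ∧
    (∀ q ∈ P, q.1 = q.2 ∨ (q.2 ⊆ C ∧ (q.1 \ q.2).card + (q.2 \ q.1).card ≤ r)) ∧
    P.countP (fun q => q.1 ≠ q.2) ≤ ℓ

/-- `V'` is obtained from `V` by selecting at most `ℓ` votes and replacing each selected
vote `v` by a vote `v'` with `v ⊆ v' ⊆ C` and `|v' \ v| ≤ r`. -/
def VoteAdditionChanges (C : Finset α) (V V' : Multiset (Finset α)) (ℓ r : ℕ) : Prop :=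
  ∃ P : Multiset (Finset α × Finset α),
    V = P.map Prod.fst ∧ V' = P.map Prod.snd ∧
    (∀ q ∈ P, q.1 = q.2 ∨ (q.1 ⊆ q.2 ∧ q.2 ⊆ C ∧ (q.2 \ q.1).card ≤ r)) ∧
    P.countP (fun q => q.1 ≠ q.2) ≤ ℓ

/-- `V'` is obtained from `V` by selecting at most `ℓ` votes and replacing each selected
vote `v` by a vote `v'` with `v' ⊆ v` and `|v \ v'| ≤ r`. -/
def VoteDeletionChanges (V V' : Multiset (Finset α)) (ℓ r : ℕ) : Prop :=
  ∃ P : Multiset (Finset α × Finset α),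
    V = P.map Prod.fst ∧ V' = P.map Prod.snd ∧
    (∀ q ∈ P, q.1 = q.2 ∨ (q.2 ⊆ q.1 ∧ (q.1 \ q.2).card ≤ r)) ∧
    P.countP (fun q => q.1 ≠ q.2) ≤ ℓ

/-- `(X, 𝒞)` is an RX3C instance with `|X| = 3κ`: `𝒞` is a collection of `3κ` many
3-element subsets of `X` and every element of `X` belongs to exactly three members of `𝒞`. -/
def IsRX3C (X : Finset α) (𝒞 : Finset (Finset α)) (κ : ℕ) : Prop :=
  X.card = 3 * κ ∧ 𝒞.card = 3 * κ ∧ (∀ H ∈ 𝒞, H ⊆ X ∧ H.card = 3) ∧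
  ∀ x ∈ X, (𝒞.filter fun H => x ∈ H).card = 3

/-- `𝒞` contains an exact cover of `X`: a subcollection `𝒞' ⊆ 𝒞` such that every element
of `X` belongs to exactly one member of `𝒞'`. -/
def HasExactCover (X : Finset α) (𝒞 : Finset (Finset α)) : Prop :=
  ∃ 𝒞' ⊆ 𝒞, ∀ x ∈ X, (𝒞'.filter fun H => x ∈ H).card = 1


/-- Double counting of the incidences between the elements of `X` and the votes in `M`. -/
theorem sum_countP_mem (X : Finset α) (M : Multiset (Finset α)) (hM : ∀ v ∈ M, v ⊆ X) :
    ∑ x ∈ X, M.countP (fun v => x ∈ v) = (M.map Finset.card).sum := by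
  induction M using Multiset.induction_on with
  | empty => simp
  | cons a M ih =>
    have ha : X ∩ a = a := Finset.inter_eq_right.2 (hM a (by simp))
    simp only [Multiset.countP_cons, Finset.sum_add_distrib, Multiset.map_cons, Multiset.sum_cons]
    rw [ih fun v hv => hM v (by simp [hv]), add_comm]
    simp [ha]

/-- The contribution of a vote to the SAV score of a candidate. -/
theorem card_inter_singleton_div (v : Finset α) (c : α) :
    ((v ∩ {c}).card : ℚ) / v.card = if c ∈ v then (v.card : ℚ)⁻¹ else 0 := by
  by_cases h : c ∈ v
  · simp [h, Finset.inter_singleton_of_mem h]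
  · simp [h, Finset.inter_singleton_of_notMem h]

theorem savCom_singleton (V : Multiset (Finset α)) (c : α) :
    savCom V {c} = savScore V c := by
  simp only [savCom, savScore, card_inter_singleton_div]

theorem savScore_add (V W : Multiset (Finset α)) (c : α) :
    savScore (V + W) c = savScore V c + savScore W c := by
  simp [savScore]

theorem savScore_val (𝒞 : Finset (Finset α)) (c : α) :
    savScore 𝒞.val c = ∑ H ∈ 𝒞, if c ∈ H then (H.card : ℚ)⁻¹ else 0 := rfl

theorem savScore_bind_replicate (X : Finset α) (n : ℕ) (c : α) :
    savScore (X.val.bind fun x => Multiset.replicate n {x}) c = if c ∈ X then (n : ℚ) else 0 := by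
  have h : savScore (X.val.bind fun x => Multiset.replicate n {x}) c
      = ∑ x ∈ X, if c = x then (n : ℚ) else 0 := by
    simp [savScore, Multiset.map_bind, Multiset.sum_bind]
  rw [h, Finset.sum_ite_eq]

theorem savScore_eq_zero {V : Multiset (Finset α)} {c : α} (h : ∀ v ∈ V, c ∉ v) :
    savScore V c = 0 := by
  refine Multiset.sum_eq_zero fun y hy => ?_
  obtain ⟨v, hv, rfl⟩ := Multiset.mem_map.1 hy
  simp [h v hv]

/-- No candidate of `X` wins alone iff `p` scores strictly better than all of `X`. -/
theorem forall_winning_notMem_iff (X : Finset α) (p : α) (V : Multiset (Finset α)) :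
    (∀ w, IsWinningCommittee (insert p X) 1 (savCom V) w → ∀ x ∈ X, x ∉ w) ↔
      ∀ x ∈ X, savScore V x < savScore V p := by
  constructor
  · intro h x hx
    by_contra! hle
    obtain ⟨y, hy, hmax⟩ := Finset.exists_max_image X (savScore V) ⟨x, hx⟩
    refine h {y} ⟨by simp [hy], by simp, fun w' hw' hc => ?_⟩ y hy (by simp)
    obtain ⟨z, rfl⟩ := Finset.card_eq_one.1 hc
    rw [savCom_singleton, savCom_singleton]
    rcases Finset.mem_insert.1 (Finset.singleton_subset_iff.1 hw') with rfl | hz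
    · exact hle.trans (hmax x hx)
    · exact hmax z hz
  · rintro h w ⟨-, hc, hmax⟩ x hx hxw
    obtain ⟨z, rfl⟩ := Finset.card_eq_one.1 hc
    obtain rfl := Finset.mem_singleton.1 hxw
    have := hmax {p} (by simp) (by simp)
    rw [savCom_singleton, savCom_singleton] at this
    exact (h x hx).not_ge this

theorem IsRX3C.savScore_eq {X : Finset α} {𝒞 : Finset (Finset α)} {κ : ℕ} (hR : IsRX3C X 𝒞 κ)
    {x : α} (hx : x ∈ X) : savScore 𝒞.val x = 1 := by
  obtain ⟨-, -, h3, hdeg⟩ := hR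
  rw [savScore_val, ← Finset.sum_filter,
    Finset.sum_congr rfl (g := fun _ => (3 : ℚ)⁻¹)
      fun H hH => by rw [(h3 H (Finset.mem_filter.1 hH).1).2]; norm_num]
  simp [hdeg x hx]

/-- A candidate that none of the original votes approves gains at most one point per changed
vote. -/
theorem savScore_map_snd_le (P : Multiset (Finset α × Finset α)) (p : α)
    (hP : ∀ q ∈ P, p ∉ q.1) :
    savScore (P.map Prod.snd) p ≤ P.countP (fun q => q.1 ≠ q.2) := by
  induction P using Multiset.induction_on with
  | empty => simp [savScore]
  | cons a P ih =>
    have ih := ih fun q hq => hP q (by simp [hq])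
    have ha : (if p ∈ a.2 then (a.2.card : ℚ)⁻¹ else 0) ≤ if a.1 ≠ a.2 then 1 else 0 := by
      have hpa := hP a (by simp)
      by_cases h : p ∈ a.2
      · have hne : a.1 ≠ a.2 := fun e => hpa (e ▸ h)
        simpa [h, hne] using Nat.cast_inv_le_one (α := ℚ) a.2.card
      · simp only [h, if_false]
        split_ifs <;> norm_num
    simp only [savScore, Multiset.map_cons, Multiset.sum_cons, Multiset.countP_cons,
      Nat.cast_add, Nat.cast_ite, Nat.cast_one, Nat.cast_zero] at ih ⊢
    linarith

/-- A candidate loses score only if some changed vote approved it. -/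
theorem savScore_map_fst_le (P : Multiset (Finset α × Finset α)) (x : α)
    (hP : ∀ q ∈ P, q.1 ≠ q.2 → x ∉ q.1) :
    savScore (P.map Prod.fst) x ≤ savScore (P.map Prod.snd) x := by
  simp only [savScore, Multiset.map_map, Function.comp_def]
  refine Multiset.sum_map_le_sum_map _ _ fun q hq => ?_
  by_cases h : q.1 = q.2
  · rw [h]
  · rw [if_neg (hP q hq h)]
    split_ifs <;> positivity

/-- A multiset of at most `κ` sets of size at most three that covers `X`, `|X| = 3κ`, consists of
pairwise disjoint triples. -/
theorem countP_eq_one_of_cover {X : Finset α} {κ : ℕ} (hX : X.card = 3 * κ)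
    {M : Multiset (Finset α)} (hsub : ∀ v ∈ M, v ⊆ X) (hM3 : ∀ v ∈ M, v.card ≤ 3)
    (hM : M.card ≤ κ) (hcov : ∀ x ∈ X, 1 ≤ M.countP (fun v => x ∈ v)) :
    (∀ x ∈ X, M.countP (fun v => x ∈ v) = 1) ∧ ∀ v ∈ M, v.card = 3 := by
  have hcount := sum_countP_mem X M hsub
  have hlow : 3 * κ ≤ ∑ x ∈ X, M.countP (fun v => x ∈ v) := by
    calc 3 * κ = ∑ x ∈ X, 1 := by simp [hX]
      _ ≤ _ := Finset.sum_le_sum hcov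
  have hup : ∀ N ≤ M, (N.map Finset.card).sum ≤ N.card * 3 := fun N hN => by
    simpa using Multiset.sum_le_card_nsmul (N.map Finset.card) 3 (by
      simpa using fun v hv => hM3 v (Multiset.mem_of_le hN hv))
  have hupM := hup M le_rfl
  refine ⟨fun x hx => ?_, fun v hv => ?_⟩
  · refine ((Finset.sum_eq_sum_iff_of_le hcov).1 ?_ x hx).symm
    simp only [Finset.sum_const, smul_eq_mul, mul_one]
    omega
  · obtain ⟨N, rfl⟩ := Multiset.exists_cons_of_mem hv
    have hN := hup N (Multiset.le_cons_self N v)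
    have hv3 := hM3 v hv
    simp only [Multiset.map_cons, Multiset.sum_cons, Multiset.card_cons] at hcount hM
    omega

theorem card_eq_of_exact_cover {X : Finset α} {𝒞 : Finset (Finset α)} {κ : ℕ}
    (hX : X.card = 3 * κ) (h3 : ∀ H ∈ 𝒞, H ⊆ X ∧ H.card = 3)
    (hcov : ∀ x ∈ X, (𝒞.filter fun H => x ∈ H).card = 1) : 𝒞.card = κ := by
  have h := sum_countP_mem X 𝒞.val fun v hv => (h3 v hv).1
  have h₁ : ∑ x ∈ X, 𝒞.val.countP (fun v => x ∈ v) = 3 * κ := by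
    rw [← hX, Finset.card_eq_sum_ones]
    refine Finset.sum_congr rfl fun x hx => ?_
    rw [Multiset.countP_eq_card_filter]
    exact hcov x hx
  have h₂ : (𝒞.val.map Finset.card).sum = 𝒞.card * 3 :=
    Finset.sum_const_nat fun H hH => (h3 H hH).2
  omega

theorem HasExactCover.of_voteChanges {X : Finset α} {𝒞 : Finset (Finset α)} {κ r : ℕ}
    (hκ : 1 ≤ κ) (hR : IsRX3C X 𝒞 κ) {p : α} (hp : p ∉ X) {V' : Multiset (Finset α)}
    (hV : VoteChanges (insert p X)
      (X.val.bind (fun x => Multiset.replicate (κ - 1) {x}) + 𝒞.val) V' κ r)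
    (hs : ∀ x ∈ X, savScore V' x < savScore V' p) : HasExactCover X 𝒞 := by
  obtain ⟨P, hfst, rfl, -, hcnt⟩ := hV
  obtain ⟨hX, -, h3, -⟩ := id hR
  have hvote : ∀ q ∈ P, (∃ x ∈ X, q.1 = {x}) ∨ q.1 ∈ 𝒞 := fun q hq => by
    have hm := hfst ▸ Multiset.mem_map_of_mem Prod.fst hq
    rcases Multiset.mem_add.1 hm with h | h
    · obtain ⟨x, hx, h⟩ := Multiset.mem_bind.1 h
      exact .inl ⟨x, hx, Multiset.eq_of_mem_replicate h⟩
    · exact .inr h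
  have hsub : ∀ q ∈ P, q.1 ⊆ X := fun q hq => by
    rcases hvote q hq with ⟨x, hx, h⟩ | h
    · simpa [h] using hx
    · exact (h3 _ h).1
  set M := (P.filter fun q => q.1 ≠ q.2).map Prod.fst with hMdef
  have hmem : ∀ v ∈ M, ∃ q ∈ P, q.1 ≠ q.2 ∧ q.1 = v := fun v hv => by
    obtain ⟨q, hq, rfl⟩ := Multiset.mem_map.1 hv
    exact ⟨q, Multiset.mem_of_mem_filter hq, (Multiset.mem_filter.1 hq).2, rfl⟩
  have hcov : ∀ x ∈ X, 1 ≤ M.countP (fun v => x ∈ v) := fun x hx => by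
    rw [Nat.one_le_iff_ne_zero, ← Nat.pos_iff_ne_zero, Multiset.countP_pos]
    by_contra! hnot
    have h₁ := savScore_map_snd_le P p fun q hq hpq => hp (hsub q hq hpq)
    have h₂ := savScore_map_fst_le P x fun q hq hne =>
      hnot _ (Multiset.mem_map_of_mem _ (Multiset.mem_filter.2 ⟨hq, hne⟩))
    rw [← hfst, savScore_add, savScore_bind_replicate, if_pos hx, hR.savScore_eq hx,
      Nat.cast_sub hκ, Nat.cast_one, sub_add_cancel] at h₂
    have h₃ : (P.countP (fun q => q.1 ≠ q.2) : ℚ) ≤ κ := by exact_mod_cast hcnt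
    linarith [hs x hx]
  obtain ⟨hone, hthree⟩ := countP_eq_one_of_cover hX (M := M)
    (fun v hv => by obtain ⟨q, hq, -, rfl⟩ := hmem v hv; exact hsub q hq)
    (fun v hv => by
      obtain ⟨q, hq, -, rfl⟩ := hmem v hv
      rcases hvote q hq with ⟨x, -, h⟩ | h
      · simp [h]
      · exact (h3 _ h).2.le)
    (by rwa [hMdef, Multiset.card_map, ← Multiset.countP_eq_card_filter]) hcov
  refine ⟨M.toFinset, fun v hv => ?_, fun x hx => le_antisymm ?_ ?_⟩
  · have hv := Multiset.mem_toFinset.1 hv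
    have hc := hthree v hv
    obtain ⟨q, hq, -, rfl⟩ := hmem v hv
    rcases hvote q hq with ⟨x, -, h⟩ | h
    · simp [h] at hc
    · exact h
  · rw [← hone x hx, Multiset.countP_eq_card_filter, ← Multiset.toFinset_filter]
    exact Multiset.toFinset_card_le _
  · obtain ⟨v, hv, hxv⟩ := Multiset.countP_pos.1 (hcov x hx)
    exact Finset.card_pos.2 ⟨v, by simp [hv, hxv]⟩

theorem HasExactCover.exists_voteChanges {X : Finset α} {𝒞 : Finset (Finset α)} {κ r : ℕ}
    (hκ : 1 ≤ κ) (hr : 4 ≤ r) (hR : IsRX3C X 𝒞 κ) {p : α} (hp : p ∉ X)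
    (h : HasExactCover X 𝒞) :
    ∃ V', VoteChanges (insert p X)
        (X.val.bind (fun x => Multiset.replicate (κ - 1) {x}) + 𝒞.val) V' κ r ∧
      ∀ x ∈ X, savScore V' x < savScore V' p := by
  obtain ⟨𝒟, h𝒟, hcov⟩ := h
  obtain ⟨hX, -, h3, -⟩ := id hR
  have hcard : 𝒟.card = κ := card_eq_of_exact_cover hX (fun H hH => h3 H (h𝒟 hH)) hcov
  have hpH : ∀ H ∈ 𝒞, p ∉ H := fun H hH h => hp ((h3 H hH).1 h)
  set B := X.val.bind (fun x => Multiset.replicate (κ - 1) ({x} : Finset α)) with hB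
  set g : Finset α → Finset α := fun H => if H ∈ 𝒟 then {p} else H with hg
  have hscore : ∀ c, savScore (B + 𝒞.val.map g) c =
      (if c ∈ X then ((κ - 1 : ℕ) : ℚ) else 0) +
        ∑ H ∈ 𝒞, if c ∈ g H then ((g H).card : ℚ)⁻¹ else 0 := fun c => by
    rw [savScore_add, hB, savScore_bind_replicate]
    simp [savScore]
  refine ⟨B + 𝒞.val.map g, ⟨B.map (fun v => (v, v)) + 𝒞.val.map (fun H => (H, g H)), ?_, ?_,
    ?_, ?_⟩, fun x hx => ?_⟩
  · simp [Multiset.map_map]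
  · simp [Multiset.map_map]
  · intro q hq
    rcases Multiset.mem_add.1 hq with hq | hq <;> obtain ⟨v, hv, rfl⟩ := Multiset.mem_map.1 hq
    · exact .inl rfl
    · by_cases hD : v ∈ 𝒟
      · right
        have h₁ := Finset.card_le_card (Finset.sdiff_subset (s := v) (t := {p}))
        have h₂ := Finset.card_le_card (Finset.sdiff_subset (s := {p}) (t := v))
        have h₃ := (h3 v hv).2
        simp only [hg, hD, if_true, Finset.card_singleton] at h₂ ⊢
        exact ⟨by simp, by omega⟩
      · exact .inl (by simp [hg, hD])
  · rw [Multiset.countP_add, Multiset.countP_map, Multiset.countP_map]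
    have h₁ : B.filter (fun v => (v, v).1 ≠ (v, v).2) = 0 := by simp
    have h₂ : 𝒞.filter (fun H => (H, g H).1 ≠ (H, g H).2) ⊆ 𝒟 := fun H hH => by
      by_contra hD
      simp [hg, hD] at hH
    rw [h₁, ← hcard, Multiset.card_zero, zero_add]
    exact Finset.card_le_card h₂
  · have hpsum : ∑ H ∈ 𝒞, (if p ∈ g H then ((g H).card : ℚ)⁻¹ else 0) = κ := by
      rw [Finset.sum_congr rfl (g := fun H => if H ∈ 𝒟 then (1 : ℚ) else 0) fun H hH => by
        by_cases hD : H ∈ 𝒟 <;> simp [hg, hD, hpH H hH]]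
      rw [Finset.sum_boole, Finset.filter_mem_eq_inter, Finset.inter_eq_right.2 h𝒟, hcard]
    have hxp : x ≠ p := fun e => hp (e ▸ hx)
    have hxsum : ∑ H ∈ 𝒞, (if x ∈ g H then ((g H).card : ℚ)⁻¹ else 0) < 1 := by
      rw [← hR.savScore_eq hx, savScore_val]
      obtain ⟨D, hD⟩ := Finset.card_pos.1 ((hcov x hx).symm ▸ Nat.one_pos)
      obtain ⟨hD, hxD⟩ := Finset.mem_filter.1 hD
      refine Finset.sum_lt_sum (fun H _ => ?_) ⟨D, h𝒟 hD, ?_⟩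
      · by_cases hH : H ∈ 𝒟
        · simp only [hg, hH, if_true, Finset.mem_singleton, hxp, if_false]
          split_ifs <;> positivity
        · simp [hg, hH]
      · simp [hg, hD, hxD, hxp, (h3 D (h𝒟 hD)).2]
    rw [hscore, hscore, if_pos hx, if_neg hp, hpsum, Nat.cast_sub hκ, Nat.cast_one]
    linarith

/-- destructive bribery by changing at most `κ` votes (each within Hamming
distance `r ≥ 4`) under SAV in the election built from an RX3C instance succeeds iff the
instance has an exact cover. -/
theorem vc_sav_rx3c
    (X : Finset α) (𝒞 : Finset (Finset α)) (κ r : ℕ)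
    (hκ : 1 ≤ κ) (hr : 4 ≤ r) (hR : IsRX3C X 𝒞 κ)
    (p : α) (hp : p ∉ X) :
    (∃ V' : Multiset (Finset α),
        VoteChanges (insert p X)
          (X.val.bind (fun x => Multiset.replicate (κ - 1) {x}) + 𝒞.val) V' κ r ∧
        ∀ w, IsWinningCommittee (insert p X) 1 (savCom V') w → ∀ x ∈ X, x ∉ w)
    ↔ HasExactCover X 𝒞 := by
  simp only [forall_winning_notMem_iff]
  exact ⟨fun ⟨_, hV, hs⟩ => .of_voteChanges hκ hR hp hV hs,
    HasExactCover.exists_voteChanges hκ hr hR hp⟩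

end ApprovalBribery
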